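/- Let N, D, R, d be positive integers with D = R·d, and let M, M_θ ≥ 0. For each r ∈ {1,…,R}, let Q^(r), K^(r), V^(r) ∈ ℝ^{D×d} and let W ∈ ℝ^{D×D}, and assume all of these matrices have Frobenius norm at most M_θ. Define the single-head self-attention maps f^(r)(X) = softmax(X Q^(r) (X K^(r))^⊤ / √d) · X V^(r) for X ∈ ℝ^{N×D} (softmax applied row-wise), and the multi-head self-attention F(X) = [f^(1)(X), …, f^(R)(X)] · W, where [·,…,·] denotes horizontal concatenation into an N×D matrix. Then F is Lipschitz on the set {X ∈ ℝ^{N×D} : ‖X‖_F ≤ M} with respect to the Frobenius norm, with Lipschitz constant at most √R · M_θ² · ( (M_θ² / √d) · M² · (√N + 1) + √N ). -/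

import Mathlib

open scoped Matrix

/-- Frobenius norm of a real matrix. -/
noncomputable def frobNorm {m n : Type*} [Fintype m] [Fintype n] (X : Matrix m n ℝ) : ℝ :=
  Real.sqrt (∑ i, ∑ j, (X i j) ^ 2)

/-- Spectral norm (operator norm induced by Euclidean norms) of a real matrix. -/
noncomputable def specNorm {m n : ℕ} (A : Matrix (Fin m) (Fin n) ℝ) : ℝ :=
  ‖(Matrix.toEuclideanLin A).toContinuousLinearMap‖

/-- Euclidean norm of a vector in ℝ^n. -/
noncomputable def evNorm {n : ℕ} (v : Fin n → ℝ) : ℝ := Real.sqrt (∑ i, (v i) ^ 2)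

/-- Row-wise softmax of a square matrix. -/
noncomputable def softmax {N : ℕ} (M : Matrix (Fin N) (Fin N) ℝ) : Matrix (Fin N) (Fin N) ℝ :=
  Matrix.of fun i j => Real.exp (M i j) / ∑ k, Real.exp (M i k)

/-- Horizontal concatenation `[f 0, f 1, …, f (R-1)]` of `R` matrices of size `m × n`
into a single `m × (R·n)` matrix (block `r` occupies columns `r·n, …, r·n + n - 1`). -/
def hConcat {m n R : ℕ} (f : Fin R → Matrix (Fin m) (Fin n) ℝ) :
    Matrix (Fin m) (Fin (R * n)) ℝ :=
  Matrix.of fun i j => f j.divNat i j.modNat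

/-- Vertical stacking of `R` matrices of size `m × n` into a single `(R·m) × n` matrix
(block `r` occupies rows `r·m, …, r·m + m - 1`). -/
def vConcat {m n R : ℕ} (f : Fin R → Matrix (Fin m) (Fin n) ℝ) :
    Matrix (Fin (R * m)) (Fin n) ℝ :=
  Matrix.of fun i j => f i.divNat i.modNat j

section FrobNorm

attribute [local instance] Matrix.frobeniusNormedAddCommGroup Matrix.frobeniusNormedSpace

variable {l m n : Type*} [Fintype l] [Fintype m] [Fintype n]

theorem frobNorm_eq_norm (X : Matrix m n ℝ) : frobNorm X = ‖X‖ := by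
  simp [frobNorm, Matrix.frobenius_norm_def, Real.sqrt_eq_rpow]

theorem frobNorm_nonneg (X : Matrix m n ℝ) : 0 ≤ frobNorm X :=
  Real.sqrt_nonneg _

theorem frobNorm_sq (X : Matrix m n ℝ) : frobNorm X ^ 2 = ∑ i, ∑ j, X i j ^ 2 :=
  Real.sq_sqrt (Finset.sum_nonneg fun _ _ => Finset.sum_nonneg fun _ _ => sq_nonneg _)

theorem frobNorm_add_le (X Y : Matrix m n ℝ) :
    frobNorm (X + Y) ≤ frobNorm X + frobNorm Y := by
  simpa only [frobNorm_eq_norm] using norm_add_le X Y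

theorem frobNorm_smul (c : ℝ) (X : Matrix m n ℝ) : frobNorm (c • X) = |c| * frobNorm X := by
  simpa only [frobNorm_eq_norm, Real.norm_eq_abs] using norm_smul c X

theorem frobNorm_transpose (X : Matrix m n ℝ) : frobNorm Xᵀ = frobNorm X := by
  simpa only [frobNorm_eq_norm] using Matrix.frobenius_norm_transpose X

theorem frobNorm_mul_le (X : Matrix l m ℝ) (Y : Matrix m n ℝ) :
    frobNorm (X * Y) ≤ frobNorm X * frobNorm Y := by
  simpa only [frobNorm_eq_norm] using Matrix.frobenius_norm_mul X Y

theorem frobNorm_mul_le_of_le {X : Matrix l m ℝ} {Y : Matrix m n ℝ} {a b : ℝ}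
    (hX : frobNorm X ≤ a) (hY : frobNorm Y ≤ b) : frobNorm (X * Y) ≤ a * b :=
  (frobNorm_mul_le X Y).trans
    (mul_le_mul hX hY (frobNorm_nonneg Y) ((frobNorm_nonneg X).trans hX))

end FrobNorm

theorem frobNorm_hConcat_sq {m n R : ℕ} (f : Fin R → Matrix (Fin m) (Fin n) ℝ) :
    frobNorm (hConcat f) ^ 2 = ∑ r, frobNorm (f r) ^ 2 := by
  simp only [frobNorm_sq]
  rw [Finset.sum_comm (s := (Finset.univ : Finset (Fin R)))]
  refine Finset.sum_congr rfl fun i _ => ?_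
  rw [← Fintype.sum_prod_type']
  exact Fintype.sum_equiv finProdFinEquiv.symm _ _ fun _ => rfl

theorem frobNorm_hConcat_le {m n R : ℕ} (f : Fin R → Matrix (Fin m) (Fin n) ℝ) {c : ℝ}
    (hc : 0 ≤ c) (hf : ∀ r, frobNorm (f r) ≤ c) :
    frobNorm (hConcat f) ≤ Real.sqrt R * c := by
  refine le_of_sq_le_sq ?_ (by positivity)
  rw [frobNorm_hConcat_sq, mul_pow, Real.sq_sqrt (Nat.cast_nonneg R)]
  calc ∑ r, frobNorm (f r) ^ 2 ≤ ∑ _r : Fin R, c ^ 2 :=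
        Finset.sum_le_sum fun r _ => pow_le_pow_left₀ (frobNorm_nonneg _) (hf r) 2
    _ = R * c ^ 2 := by simp

/-- The covariance matrix `diag p - p pᵀ` of a probability vector `p` contracts the
Euclidean norm. -/
theorem sum_sq_mul_sub_mean_le {ι : Type*} [Fintype ι] (p v : ι → ℝ) (hp : ∀ i, 0 ≤ p i)
    (hsum : ∑ i, p i = 1) :
    ∑ i, (p i * (v i - ∑ k, p k * v k)) ^ 2 ≤ ∑ i, v i ^ 2 := by
  have hp1 : ∀ i, p i ≤ 1 := fun i =>
    hsum ▸ Finset.single_le_sum (fun j _ => hp j) (Finset.mem_univ i)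
  set a := ∑ k, p k * v k with ha
  calc ∑ i, (p i * (v i - a)) ^ 2 ≤ ∑ i, p i * (v i - a) ^ 2 := by
        refine Finset.sum_le_sum fun i _ => ?_
        rw [mul_pow]
        exact mul_le_mul_of_nonneg_right (by nlinarith [hp i, hp1 i]) (sq_nonneg _)
    _ = ∑ i, p i * v i ^ 2 - a ^ 2 := by
        have h : ∀ i, p i * (v i - a) ^ 2 = p i * v i ^ 2 - 2 * a * (p i * v i) + a ^ 2 * p i :=
          fun i => by ring
        simp only [h, Finset.sum_add_distrib, Finset.sum_sub_distrib, ← Finset.mul_sum, hsum, ← ha]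
        ring
    _ ≤ ∑ i, p i * v i ^ 2 := by linarith [sq_nonneg a]
    _ ≤ ∑ i, v i ^ 2 := Finset.sum_le_sum fun i _ =>
        mul_le_of_le_one_left (sq_nonneg _) (hp1 i)

theorem hasDerivAt_exp_div_sum_exp {ι : Type*} [Fintype ι] [Nonempty ι] (x v : ι → ℝ) (i : ι)
    (t : ℝ) :
    HasDerivAt (fun s => Real.exp (x i + s * v i) / ∑ k, Real.exp (x k + s * v k))
      (Real.exp (x i + t * v i) / (∑ k, Real.exp (x k + t * v k)) *
        (v i - ∑ j, Real.exp (x j + t * v j) / (∑ k, Real.exp (x k + t * v k)) * v j)) t := by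
  have he : ∀ k, HasDerivAt (fun s => Real.exp (x k + s * v k))
      (Real.exp (x k + t * v k) * v k) t := fun k => by
    simpa using (((hasDerivAt_id t).mul_const (v k)).const_add (x k)).exp
  have hZ : HasDerivAt (fun s => ∑ k, Real.exp (x k + s * v k))
      (∑ k, Real.exp (x k + t * v k) * v k) t :=
    HasDerivAt.fun_sum fun k _ => he k
  have hpos : 0 < ∑ k, Real.exp (x k + t * v k) :=
    Finset.sum_pos (fun _ _ => Real.exp_pos _) Finset.univ_nonempty
  refine ((he i).fun_div hZ hpos.ne').congr_deriv ?_
  simp only [div_mul_eq_mul_div, ← Finset.sum_div]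
  field_simp

/-- The softmax of a vector is a `1`-Lipschitz function for the Euclidean norm. -/
theorem sum_sq_softmax_sub_le {ι : Type*} [Fintype ι] [Nonempty ι] (x y : ι → ℝ) :
    ∑ i, (Real.exp (y i) / ∑ k, Real.exp (y k) - Real.exp (x i) / ∑ k, Real.exp (x k)) ^ 2 ≤
      ∑ i, (y i - x i) ^ 2 := by
  set u : ι → ℝ := fun i =>
    Real.exp (y i) / ∑ k, Real.exp (y k) - Real.exp (x i) / ∑ k, Real.exp (x k)
  set v : ι → ℝ := fun i => y i - x i with hv
  have hderiv : ∀ t, HasDerivAt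
      (fun s => ∑ i, u i * (Real.exp (x i + s * v i) / ∑ k, Real.exp (x k + s * v k))) _ t :=
    fun t => HasDerivAt.fun_sum fun i _ => (hasDerivAt_exp_div_sum_exp x v i t).const_mul (u i)
  obtain ⟨t, -, ht⟩ := exists_hasDerivAt_eq_slope _ _ zero_lt_one
    (fun s _ => (hderiv s).continuousAt.continuousWithinAt) (fun s _ => hderiv s)
  have hpos : 0 < ∑ k, Real.exp (x k + t * v k) :=
    Finset.sum_pos (fun _ _ => Real.exp_pos _) Finset.univ_nonempty
  have hbound := sum_sq_mul_sub_mean_le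
    (fun i => Real.exp (x i + t * v i) / ∑ k, Real.exp (x k + t * v k)) v
    (fun i => by positivity) (by rw [← Finset.sum_div, div_self hpos.ne'])
  have hslope : ∑ i, u i ^ 2 = ∑ i, u i * (Real.exp (x i + t * v i) /
      (∑ k, Real.exp (x k + t * v k)) *
        (v i - ∑ j, Real.exp (x j + t * v j) / (∑ k, Real.exp (x k + t * v k)) * v j)) := by
    rw [ht]
    simp only [hv, one_mul, zero_mul, add_zero, sub_zero, div_one, add_sub_cancel,
      ← Finset.sum_sub_distrib, ← mul_sub]
    exact Finset.sum_congr rfl fun i _ => sq (u i)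
  have hcs := Finset.sum_mul_sq_le_sq_mul_sq Finset.univ u
    (fun i => Real.exp (x i + t * v i) / (∑ k, Real.exp (x k + t * v k)) *
        (v i - ∑ j, Real.exp (x j + t * v j) / (∑ k, Real.exp (x k + t * v k)) * v j))
  rw [← hslope] at hcs
  have hnonneg : 0 ≤ ∑ i, u i ^ 2 := Finset.sum_nonneg fun i _ => sq_nonneg _
  rcases hnonneg.eq_or_lt with h0 | h0
  · rw [← h0]
    exact Finset.sum_nonneg fun i _ => sq_nonneg _
  · rw [sq (∑ i, u i ^ 2)] at hcs
    exact (le_of_mul_le_mul_left hcs h0).trans hbound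

theorem frobNorm_softmax_sub_le {N : ℕ} (A B : Matrix (Fin N) (Fin N) ℝ) :
    frobNorm (softmax A - softmax B) ≤ frobNorm (A - B) := by
  refine Real.sqrt_le_sqrt (Finset.sum_le_sum fun i _ => ?_)
  have : Nonempty (Fin N) := ⟨i⟩
  exact sum_sq_softmax_sub_le (B i) (A i)

theorem frobNorm_softmax_le {N : ℕ} (A : Matrix (Fin N) (Fin N) ℝ) :
    frobNorm (softmax A) ≤ Real.sqrt N := by
  refine Real.sqrt_le_sqrt ?_
  calc ∑ i, ∑ j, softmax A i j ^ 2 ≤ ∑ _i : Fin N, (1 : ℝ) := by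
        refine Finset.sum_le_sum fun i _ => ?_
        have hpos : 0 < ∑ k, Real.exp (A i k) :=
          Finset.sum_pos (fun _ _ => Real.exp_pos _) ⟨i, Finset.mem_univ i⟩
        have hnonneg : ∀ j, 0 ≤ softmax A i j := fun j =>
          div_nonneg (Real.exp_pos _).le hpos.le
        have hsum : ∑ j, softmax A i j = 1 := by
          simp only [softmax, Matrix.of_apply]
          rw [← Finset.sum_div, div_self hpos.ne']
        calc ∑ j, softmax A i j ^ 2 ≤ (∑ j, softmax A i j) ^ 2 :=
              Finset.sum_sq_le_sq_sum_of_nonneg fun j _ => hnonneg j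
          _ = 1 := by rw [hsum, one_pow]
    _ = N := by simp

theorem frobNorm_attentionScores_sub_le {m n k : Type*} [Fintype m] [Fintype n] [Fintype k]
    {M Mθ : ℝ} (c : ℝ) {Q K : Matrix n k ℝ} {X Y : Matrix m n ℝ}
    (hQ : frobNorm Q ≤ Mθ) (hK : frobNorm K ≤ Mθ) (hX : frobNorm X ≤ M) (hY : frobNorm Y ≤ M) :
    frobNorm (c • (X * Q * (X * K)ᵀ) - c • (Y * Q * (Y * K)ᵀ)) ≤
      |c| * (2 * Mθ ^ 2 * M) * frobNorm (X - Y) := by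
  have hsplit : c • (X * Q * (X * K)ᵀ) - c • (Y * Q * (Y * K)ᵀ) =
      c • ((X - Y) * Q * (X * K)ᵀ + Y * Q * ((X - Y) * K)ᵀ) := by
    simp only [Matrix.sub_mul, Matrix.transpose_sub, Matrix.mul_sub, ← smul_sub]
    congr 1
    abel
  have h₁ : frobNorm ((X - Y) * Q * (X * K)ᵀ) ≤ frobNorm (X - Y) * Mθ * (M * Mθ) :=
    frobNorm_mul_le_of_le (frobNorm_mul_le_of_le le_rfl hQ)
      ((frobNorm_transpose _).trans_le (frobNorm_mul_le_of_le hX hK))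
  have h₂ : frobNorm (Y * Q * ((X - Y) * K)ᵀ) ≤ M * Mθ * (frobNorm (X - Y) * Mθ) :=
    frobNorm_mul_le_of_le (frobNorm_mul_le_of_le hY hQ)
      ((frobNorm_transpose _).trans_le (frobNorm_mul_le_of_le le_rfl hK))
  rw [hsplit, frobNorm_smul, mul_assoc]
  refine mul_le_mul_of_nonneg_left ?_ (abs_nonneg c)
  linarith [frobNorm_add_le ((X - Y) * Q * (X * K)ᵀ) (Y * Q * ((X - Y) * K)ᵀ)]

theorem frobNorm_selfAttention_sub_le {N : ℕ} {n k : Type*} [Fintype n] [Fintype k]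
    {M Mθ : ℝ} (c : ℝ) {Q K V : Matrix n k ℝ} {X Y : Matrix (Fin N) n ℝ}
    (hQ : frobNorm Q ≤ Mθ) (hK : frobNorm K ≤ Mθ) (hV : frobNorm V ≤ Mθ)
    (hX : frobNorm X ≤ M) (hY : frobNorm Y ≤ M) :
    frobNorm (softmax (c • (X * Q * (X * K)ᵀ)) * (X * V) -
        softmax (c • (Y * Q * (Y * K)ᵀ)) * (Y * V)) ≤
      Mθ * (|c| * Mθ ^ 2 * M ^ 2 * 2 + Real.sqrt N) * frobNorm (X - Y) := by
  set A := c • (X * Q * (X * K)ᵀ)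
  set B := c • (Y * Q * (Y * K)ᵀ)
  have hsplit : softmax A * (X * V) - softmax B * (Y * V) =
      (softmax A - softmax B) * (X * V) + softmax B * ((X - Y) * V) := by
    simp only [Matrix.sub_mul, Matrix.mul_sub]
    abel
  have h₁ : frobNorm ((softmax A - softmax B) * (X * V)) ≤
      |c| * (2 * Mθ ^ 2 * M) * frobNorm (X - Y) * (M * Mθ) :=
    frobNorm_mul_le_of_le
      ((frobNorm_softmax_sub_le A B).trans (frobNorm_attentionScores_sub_le c hQ hK hX hY))
      (frobNorm_mul_le_of_le hX hV)
  have h₂ : frobNorm (softmax B * ((X - Y) * V)) ≤ Real.sqrt N * (frobNorm (X - Y) * Mθ) :=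
    frobNorm_mul_le_of_le (frobNorm_softmax_le B) (frobNorm_mul_le_of_le le_rfl hV)
  rw [hsplit]
  linarith [frobNorm_add_le ((softmax A - softmax B) * (X * V)) (softmax B * ((X - Y) * V))]

/-- Multi-head dot-product self-attention with parameter matrices of
Frobenius norm at most `Mθ` is Lipschitz on the Frobenius ball of radius `M`, with
Lipschitz constant at most `√R · Mθ² · ((Mθ²/√d) · M² · (√N + 1) + √N)`. -/
theorem multihead_selfattention_locally_lipschitz
    (N R d : ℕ) (hN : 0 < N) (hR : 0 < R) (hd : 0 < d)
    (M Mθ : ℝ) (hM : 0 ≤ M) (hMθ : 0 ≤ Mθ)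
    (Q K V : Fin R → Matrix (Fin (R * d)) (Fin d) ℝ)
    (W : Matrix (Fin (R * d)) (Fin (R * d)) ℝ)
    (hQ : ∀ r, frobNorm (Q r) ≤ Mθ) (hK : ∀ r, frobNorm (K r) ≤ Mθ)
    (hV : ∀ r, frobNorm (V r) ≤ Mθ) (hW : frobNorm W ≤ Mθ)
    (f : Fin R → Matrix (Fin N) (Fin (R * d)) ℝ → Matrix (Fin N) (Fin d) ℝ)
    (hf : ∀ r X, f r X =
      softmax ((Real.sqrt d)⁻¹ • (X * Q r * (X * K r)ᵀ)) * (X * V r))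
    (F : Matrix (Fin N) (Fin (R * d)) ℝ → Matrix (Fin N) (Fin (R * d)) ℝ)
    (hF : ∀ X, F X = hConcat (fun r => f r X) * W) :
    ∀ X Y : Matrix (Fin N) (Fin (R * d)) ℝ, frobNorm X ≤ M → frobNorm Y ≤ M →
      frobNorm (F X - F Y) ≤
        (Real.sqrt R * Mθ ^ 2 *
          (Mθ ^ 2 / Real.sqrt d * M ^ 2 * (Real.sqrt N + 1) + Real.sqrt N)) *
          frobNorm (X - Y) := by
  intro X Y hX hY
  have hδ := frobNorm_nonneg (X - Y)
  have hN' : (2 : ℝ) ≤ Real.sqrt N + 1 := by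
    have : (1 : ℝ) ≤ Real.sqrt N := Real.one_le_sqrt.2 (by exact_mod_cast hN)
    linarith
  have hhead : ∀ r, frobNorm (f r X - f r Y) ≤
      Mθ * (Mθ ^ 2 / Real.sqrt d * M ^ 2 * (Real.sqrt N + 1) + Real.sqrt N) *
        frobNorm (X - Y) := fun r => by
    rw [hf, hf]
    refine (frobNorm_selfAttention_sub_le _ (hQ r) (hK r) (hV r) hX hY).trans ?_
    rw [abs_of_nonneg (by positivity), mul_comm (Real.sqrt d)⁻¹, ← div_eq_mul_inv]
    gcongr
  have hsplit : F X - F Y = hConcat (fun r => f r X - f r Y) * W := by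
    rw [hF, hF, ← Matrix.sub_mul]
    rfl
  rw [hsplit]
  refine (frobNorm_mul_le_of_le (frobNorm_hConcat_le _ (by positivity) hhead) hW).trans_eq ?_
  ring
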